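/- arXiv:math-ph/0201032 — 4 statements merged into one kernel-verified Lean document; each statement's English description precedes it below -/
import Mathlib

section
/- Let a(y), b(y) be continuously differentiable real functions of y alone, and set the multiplier M(x,y)·w = (a w₁ + b w₂, −(x − σ(y)) b w₁ + a w₂). Then for every pair w = (w₁,w₂) of twice continuously differentiable functions on an open subset of ℝ², the pointwise identity (L*w)₁·(Mw)₁ + (L*w)₂·(Mw)₂ = α w₁² + 2β w₁w₂ + γ w₂² + ∂ₓQ − ∂_y P holds, where α = ½[b′(y)(x − σ(y)) − b(y)σ′(y)] + (½ − K)a(y), β = −½[a′(y) + K b(y)], γ = −½ b′(y), P = −[ (b/2)(w₂² − (x − σ(y))w₁²) + a w₁w₂ ], and Q = (a/2)[(x − σ(y))w₁² − w₂²] + b(x − σ(y))w₁w₂. -/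
open Set

/-- Partial derivative in the `x`-direction. -/
noncomputable def pdx (f : ℝ × ℝ → ℝ) (z : ℝ × ℝ) : ℝ := fderiv ℝ f z (1, 0)

/-- Partial derivative in the `y`-direction. -/
noncomputable def pdy (f : ℝ × ℝ → ℝ) (z : ℝ × ℝ) : ℝ := fderiv ℝ f z (0, 1)

/-- The pointwise multiplier identity of the `abc` method:
`(L*w)·(Mw) = α w₁² + 2β w₁w₂ + γ w₂² + ∂ₓQ − ∂_yP`
for the multiplier `M w = (a w₁ + b w₂, −(x−σ(y)) b w₁ + a w₂)`. -/
theorem multiplier_identity (σ : ℝ → ℝ) (hσ : ContDiff ℝ 1 σ) (K : ℝ)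
    (a b : ℝ → ℝ) (haC1 : ContDiff ℝ 1 a) (hbC1 : ContDiff ℝ 1 b)
    (s : Set (ℝ × ℝ)) (hs : IsOpen s)
    (w₁ w₂ : ℝ × ℝ → ℝ)
    (hw₁ : ContDiffOn ℝ 2 w₁ s) (hw₂ : ContDiffOn ℝ 2 w₂ s)
    (z : ℝ × ℝ) (hz : z ∈ s) :
    ((z.1 - σ z.2) * pdx w₁ z + (1 - K) * w₁ z + pdy w₂ z)
        * (a z.2 * w₁ z + b z.2 * w₂ z)
      + (pdy w₁ z - pdx w₂ z)
        * (-(z.1 - σ z.2) * b z.2 * w₁ z + a z.2 * w₂ z)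
    = ((1 / 2) * (deriv b z.2 * (z.1 - σ z.2) - b z.2 * deriv σ z.2)
          + (1 / 2 - K) * a z.2) * w₁ z ^ 2
      + 2 * (-(1 / 2) * (deriv a z.2 + K * b z.2)) * w₁ z * w₂ z
      + (-(1 / 2) * deriv b z.2) * w₂ z ^ 2
      + pdx (fun q => a q.2 / 2 * ((q.1 - σ q.2) * w₁ q ^ 2 - w₂ q ^ 2)
          + b q.2 * (q.1 - σ q.2) * w₁ q * w₂ q) z
      - pdy (fun q => -(b q.2 / 2 * (w₂ q ^ 2 - (q.1 - σ q.2) * w₁ q ^ 2)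
          + a q.2 * w₁ q * w₂ q)) z := by
  have h₁ : HasFDerivAt w₁ (fderiv ℝ w₁ z) z :=
    ((hw₁.contDiffAt (hs.mem_nhds hz)).differentiableAt (by norm_num)).hasFDerivAt
  have h₂ : HasFDerivAt w₂ (fderiv ℝ w₂ z) z :=
    ((hw₂.contDiffAt (hs.mem_nhds hz)).differentiableAt (by norm_num)).hasFDerivAt
  have ha := ((haC1.differentiable (by norm_num)) z.2).hasDerivAt.comp_hasFDerivAt z
    (hasFDerivAt_snd (𝕜 := ℝ) (p := z))
  have hb := ((hbC1.differentiable (by norm_num)) z.2).hasDerivAt.comp_hasFDerivAt z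
    (hasFDerivAt_snd (𝕜 := ℝ) (p := z))
  have hx := (hasFDerivAt_fst (𝕜 := ℝ) (p := z)).sub
    (((hσ.differentiable (by norm_num)) z.2).hasDerivAt.comp_hasFDerivAt z
      (hasFDerivAt_snd (𝕜 := ℝ) (p := z)))
  have hQ := ((ha.mul_const (1 / 2)).mul ((hx.mul (h₁.pow 2)).sub (h₂.pow 2))).add
    (((hb.mul hx).mul h₁).mul h₂)
  have hP := (((hb.mul_const (1 / 2)).mul ((h₂.pow 2).sub (hx.mul (h₁.pow 2)))).add
    ((ha.mul h₁).mul h₂)).neg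
  have hQ' := hQ.congr_of_eventuallyEq (f₁ := fun q : ℝ × ℝ =>
    a q.2 / 2 * ((q.1 - σ q.2) * w₁ q ^ 2 - w₂ q ^ 2)
      + b q.2 * (q.1 - σ q.2) * w₁ q * w₂ q) (.of_forall fun q => by simp [div_eq_mul_inv])
  have hP' := hP.congr_of_eventuallyEq (f₁ := fun q : ℝ × ℝ =>
    -(b q.2 / 2 * (w₂ q ^ 2 - (q.1 - σ q.2) * w₁ q ^ 2)
      + a q.2 * w₁ q * w₂ q)) (.of_forall fun q => by simp [div_eq_mul_inv])
  simp only [pdx, pdy]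
  rw [hQ'.fderiv, hP'.fderiv]
  simp
  ring
end

section
/- Let K ∈ [0,1/2], ℓ > 0, δ > 0, a(y) = K[y + ℓ⁻¹∫₀^y σ(t)dt], b(y) = −[1 + σ(y)/ℓ]. Then at every point (x,y) with y ≥ 0 and x ≤ ℓ − δ one has β = 0, γ = σ′(y)/(2ℓ), and α = (σ′(y)/(2ℓ))[2σ(y) + ℓ − x] + K(½ − K)[y + ℓ⁻¹∫₀^y σ(t)dt] ≥ δσ′(y)/(2ℓ); consequently, for all real w₁, w₂, α w₁² + 2β w₁w₂ + γ w₂² ≥ (χ/(2ℓ))·σ′(y)·(w₁² + w₂²), where χ = min{δ,1}. -/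
open Set

/-- Case 1 coefficient computation for the `abc` method: with
`a(y) = K[y + ℓ⁻¹∫₀ʸ σ]` and `b(y) = −[1 + σ(y)/ℓ]` one has `β = 0`,
`γ = σ′(y)/(2ℓ)`, an explicit formula and lower bound for `α`, and the
resulting positivity of the quadratic form. -/
theorem case1_coefficients (σ : ℝ → ℝ) (hσ : ContDiff ℝ 1 σ)
    (hσ0 : σ 0 = 0) (hσ'0 : deriv σ 0 = 0)
    (hσnn : ∀ y : ℝ, 0 ≤ y → 0 ≤ σ y) (hσ'nn : ∀ y : ℝ, 0 ≤ y → 0 ≤ deriv σ y)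
    (K ℓ δ : ℝ) (hK : K ∈ Icc (0 : ℝ) (1 / 2)) (hℓ : 0 < ℓ) (hδ : 0 < δ)
    (a b : ℝ → ℝ)
    (ha : a = fun y => K * (y + ℓ⁻¹ * ∫ t in (0 : ℝ)..y, σ t))
    (hb : b = fun y => -(1 + σ y / ℓ))
    (x y : ℝ) (hy : 0 ≤ y) (hx : x ≤ ℓ - δ) :
    -(1 / 2) * (deriv a y + K * b y) = 0 ∧
    -(1 / 2) * deriv b y = deriv σ y / (2 * ℓ) ∧
    (1 / 2) * (deriv b y * (x - σ y) - b y * deriv σ y) + (1 / 2 - K) * a y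
      = deriv σ y / (2 * ℓ) * (2 * σ y + ℓ - x)
        + K * (1 / 2 - K) * (y + ℓ⁻¹ * ∫ t in (0 : ℝ)..y, σ t) ∧
    δ * deriv σ y / (2 * ℓ)
      ≤ (1 / 2) * (deriv b y * (x - σ y) - b y * deriv σ y) + (1 / 2 - K) * a y ∧
    ∀ w₁ w₂ : ℝ,
      min δ 1 / (2 * ℓ) * deriv σ y * (w₁ ^ 2 + w₂ ^ 2)
        ≤ ((1 / 2) * (deriv b y * (x - σ y) - b y * deriv σ y)
              + (1 / 2 - K) * a y) * w₁ ^ 2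
          + 2 * (-(1 / 2) * (deriv a y + K * b y)) * w₁ * w₂
          + (-(1 / 2) * deriv b y) * w₂ ^ 2 := by
  obtain ⟨hK0, hK1⟩ := hK
  have hda : deriv a y = K * (1 + ℓ⁻¹ * σ y) := by
    have hint : HasDerivAt (fun y => ∫ t in (0 : ℝ)..y, σ t) (σ y) y :=
      hσ.continuous.integral_hasStrictDerivAt 0 y |>.hasDerivAt
    rw [ha]
    exact (((hasDerivAt_id' y).add (hint.const_mul ℓ⁻¹)).const_mul K).deriv
  have hdb : deriv b y = -(deriv σ y / ℓ) := by
    have hd : HasDerivAt σ (deriv σ y) y :=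
      (hσ.differentiable one_ne_zero y).hasDerivAt
    rw [hb]
    exact ((hd.div_const ℓ).const_add 1).neg.deriv
  have hay : a y = K * (y + ℓ⁻¹ * ∫ t in (0 : ℝ)..y, σ t) := by rw [ha]
  have hby : b y = -(1 + σ y / ℓ) := by rw [hb]
  have hβ : -(1 / 2) * (deriv a y + K * b y) = 0 := by
    rw [hda, hby]
    ring
  have hγ : -(1 / 2) * deriv b y = deriv σ y / (2 * ℓ) := by
    rw [hdb]
    field_simp
  have hα : (1 / 2) * (deriv b y * (x - σ y) - b y * deriv σ y) + (1 / 2 - K) * a y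
      = deriv σ y / (2 * ℓ) * (2 * σ y + ℓ - x)
        + K * (1 / 2 - K) * (y + ℓ⁻¹ * ∫ t in (0 : ℝ)..y, σ t) := by
    rw [hdb, hay, hby]
    field_simp
    ring
  have hint0 : 0 ≤ ∫ t in (0 : ℝ)..y, σ t :=
    intervalIntegral.integral_nonneg hy fun t ht => hσnn t ht.1
  have hc : 0 ≤ deriv σ y / (2 * ℓ) := div_nonneg (hσ'nn y hy) (by positivity)
  have hα_ge : δ * deriv σ y / (2 * ℓ)
      ≤ (1 / 2) * (deriv b y * (x - σ y) - b y * deriv σ y) + (1 / 2 - K) * a y := by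
    rw [hα]
    have h₁ : deriv σ y / (2 * ℓ) * δ ≤ deriv σ y / (2 * ℓ) * (2 * σ y + ℓ - x) :=
      mul_le_mul_of_nonneg_left (by linarith [hσnn y hy]) hc
    have h₂ : 0 ≤ K * (1 / 2 - K) * (y + ℓ⁻¹ * ∫ t in (0 : ℝ)..y, σ t) :=
      mul_nonneg (mul_nonneg hK0 (by linarith)) (by positivity)
    calc δ * deriv σ y / (2 * ℓ) = deriv σ y / (2 * ℓ) * δ := by ring
      _ ≤ _ := by linarith
  refine ⟨hβ, hγ, hα, hα_ge, fun w₁ w₂ => ?_⟩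
  rw [hβ, hγ]
  have h₁ : deriv σ y / (2 * ℓ) * min δ 1 * w₁ ^ 2
      ≤ ((1 / 2) * (deriv b y * (x - σ y) - b y * deriv σ y) + (1 / 2 - K) * a y) * w₁ ^ 2 := by
    refine mul_le_mul_of_nonneg_right (le_trans ?_ hα_ge) (sq_nonneg w₁)
    calc deriv σ y / (2 * ℓ) * min δ 1 ≤ deriv σ y / (2 * ℓ) * δ :=
          mul_le_mul_of_nonneg_left (min_le_left δ 1) hc
      _ = δ * deriv σ y / (2 * ℓ) := by ring
  have h₂ : deriv σ y / (2 * ℓ) * min δ 1 * w₂ ^ 2 ≤ deriv σ y / (2 * ℓ) * w₂ ^ 2 :=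
    mul_le_mul_of_nonneg_right (mul_le_of_le_one_right hc (min_le_right δ 1)) (sq_nonneg w₂)
  calc min δ 1 / (2 * ℓ) * deriv σ y * (w₁ ^ 2 + w₂ ^ 2)
      = deriv σ y / (2 * ℓ) * min δ 1 * w₁ ^ 2
        + deriv σ y / (2 * ℓ) * min δ 1 * w₂ ^ 2 := by ring
    _ ≤ _ := by linarith
end

section
/- (Inequality (11)) Let σ(y) = y², K ∈ [0,1], ℓ > 0, δ > 0, a(y) = Ky, b(y) = −[1 + y²/(2ℓ)], so that α = (y/(2ℓ))(2y² + 2ℓ − x) + (½ − K)Ky, β = Ky²/(4ℓ), γ = y/(2ℓ). Then at every point (x,y) with y ≥ 0 and x ≤ ℓ − δ one has αγ − β² ≥ (y/(2ℓ))²[ℓ − x + (7/4)y²] ≥ δ(y/(2ℓ))². -/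
open Set

/-- Inequality (11): with `σ(y) = y²`, `a(y) = Ky`, `b(y) = −[1 + y²/(2ℓ)]`,
so that `α = (y/(2ℓ))(2y² + 2ℓ − x) + (½ − K)Ky`, `β = Ky²/(4ℓ)`, `γ = y/(2ℓ)`,
one has `αγ − β² ≥ (y/(2ℓ))²[ℓ − x + (7/4)y²] ≥ δ(y/(2ℓ))²` for `y ≥ 0`,
`x ≤ ℓ − δ`. -/
theorem inequality_11 (K ℓ δ : ℝ) (hK : K ∈ Icc (0 : ℝ) 1)
    (hℓ : 0 < ℓ) (hδ : 0 < δ)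
    (x y : ℝ) (hy : 0 ≤ y) (hx : x ≤ ℓ - δ)
    (α β γ : ℝ)
    (hα : α = y / (2 * ℓ) * (2 * y ^ 2 + 2 * ℓ - x) + (1 / 2 - K) * K * y)
    (hβ : β = K * y ^ 2 / (4 * ℓ))
    (hγ : γ = y / (2 * ℓ)) :
    (y / (2 * ℓ)) ^ 2 * (ℓ - x + 7 / 4 * y ^ 2) ≤ α * γ - β ^ 2 ∧
    δ * (y / (2 * ℓ)) ^ 2 ≤ (y / (2 * ℓ)) ^ 2 * (ℓ - x + 7 / 4 * y ^ 2) := by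
  obtain ⟨hK0, hK1⟩ := hK
  subst hα hβ hγ
  constructor
  · have hid : y / (2 * ℓ) * (2 * y ^ 2 + 2 * ℓ - x) * (y / (2 * ℓ))
          + (1 / 2 - K) * K * y * (y / (2 * ℓ)) - (K * y ^ 2 / (4 * ℓ)) ^ 2
        = (y / (2 * ℓ)) ^ 2 * (ℓ - x + 7 / 4 * y ^ 2)
          + (y / (2 * ℓ)) ^ 2
            * (ℓ * ((1 - K) * (1 + 2 * K)) + y ^ 2 / 4 * ((1 - K) * (1 + K))) := by
      field_simp
      ring
    have hK' : 0 ≤ 1 - K := sub_nonneg.mpr hK1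
    rw [add_mul, hid]
    exact le_add_of_nonneg_right (by positivity)
  · rw [mul_comm δ]
    exact mul_le_mul_of_nonneg_left (by linarith [sq_nonneg y]) (sq_nonneg _)
end

section
/- Let σ(y) = y², K ∈ [0,1], ℓ > 0, δ > 0, p < 0, q > 0 with ℓ − p > δ, a(y) = Ky, b(y) = −[1 + y²/(2ℓ)], so that α = (y/(2ℓ))(2y² + 2ℓ − x) + (½ − K)Ky, β = Ky²/(4ℓ), γ = y/(2ℓ). Let ε = 1 − δ/(2q² + (17/8)ℓ − p) if this number is positive (otherwise ε any number in [1 − δ/(2q² + (17/8)ℓ − p), 1) ∩ (0,1)), and set χ = min{δ,1}. Then at every point (x,y) with p ≤ x ≤ ℓ − δ and 0 ≤ y ≤ q, for all real w₁, w₂: α w₁² + 2β w₁w₂ + γ w₂² ≥ (χ(1 − √ε)/(2ℓ))·y·(w₁² + w₂²). -/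
open Set

/-- If the cross coefficient satisfies `c² ≤ 4 s² A` and `m ≤ A`, `m ≤ 1`, then the form
`A u² + c u v + v²` is bounded below by `m (1 - s) (u² + v²)`. -/
theorem quadratic_form_lower_bound {A c s m : ℝ} (hs₀ : 0 < s) (hs₁ : s ≤ 1)
    (hc : c ^ 2 ≤ 4 * (s ^ 2 * A)) (hmA : m ≤ A) (hm : m ≤ 1) (u v : ℝ) :
    m * (1 - s) * (u ^ 2 + v ^ 2) ≤ A * u ^ 2 + c * u * v + v ^ 2 := by
  have cross : 0 ≤ s * (A * u ^ 2 + v ^ 2) + c * u * v := by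
    refine nonneg_of_mul_nonneg_right ?_ hs₀
    have h : 0 ≤ (s ^ 2 * A - c ^ 2 / 4) * u ^ 2 :=
      mul_nonneg (by linarith) (sq_nonneg u)
    linarith [sq_nonneg (s * v + c * u / 2)]
  have diag : 0 ≤ (1 - s) * ((A - m) * u ^ 2 + (1 - m) * v ^ 2) :=
    mul_nonneg (by linarith) (add_nonneg
      (mul_nonneg (by linarith) (sq_nonneg u)) (mul_nonneg (by linarith) (sq_nonneg v)))
  linarith

/-- The Case 2 lower bound on the quadratic form: with `σ(y) = y²`, `a(y) = Ky`,
`b(y) = −[1 + y²/(2ℓ)]`, so that `α = (y/(2ℓ))(2y² + 2ℓ − x) + (½ − K)Ky`,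
`β = Ky²/(4ℓ)`, `γ = y/(2ℓ)`, with `ε` as in claim (13) and `χ = min{δ,1}`,
one has `α w₁² + 2β w₁w₂ + γ w₂² ≥ (χ(1 − √ε)/(2ℓ))·y·(w₁² + w₂²)` for
`p ≤ x ≤ ℓ − δ`, `0 ≤ y ≤ q`. -/
theorem case2_quadratic_bound (K ℓ δ p q : ℝ) (hK : K ∈ Icc (0 : ℝ) 1)
    (hℓ : 0 < ℓ) (hδ : 0 < δ) (hp : p < 0) (hq : 0 < q) (hℓp : δ < ℓ - p)
    (ε : ℝ) (hε₁ : 1 - δ / (2 * q ^ 2 + 17 / 8 * ℓ - p) ≤ ε) (hε₂ : ε < 1)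
    (hε₃ : 0 < ε) (χ : ℝ) (hχ : χ = min δ 1) :
    ∀ x y : ℝ, p ≤ x → x ≤ ℓ - δ → 0 ≤ y → y ≤ q →
      ∀ α β γ : ℝ,
        α = y / (2 * ℓ) * (2 * y ^ 2 + 2 * ℓ - x) + (1 / 2 - K) * K * y →
        β = K * y ^ 2 / (4 * ℓ) →
        γ = y / (2 * ℓ) →
        ∀ w₁ w₂ : ℝ,
          χ * (1 - Real.sqrt ε) / (2 * ℓ) * y * (w₁ ^ 2 + w₂ ^ 2)
            ≤ α * w₁ ^ 2 + 2 * β * w₁ * w₂ + γ * w₂ ^ 2 := by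
  rintro x y hpx hxℓ hy hyq α β γ rfl rfl rfl w₁ w₂
  obtain ⟨hK₀, hK₁⟩ := hK
  set A : ℝ := 2 * y ^ 2 + 2 * ℓ - x + ℓ * ((1 - 2 * K) * K) with hA
  have hA_lower : δ + 2 * y ^ 2 ≤ A := by
    have h : 0 ≤ ℓ * ((1 - K) * (1 + 2 * K)) :=
      mul_nonneg hℓ.le (mul_nonneg (by linarith) (by linarith))
    rw [hA]
    linarith
  have hA_upper : A ≤ 2 * q ^ 2 + 17 / 8 * ℓ - p := by
    have h : 0 ≤ ℓ * (1 - 4 * K) ^ 2 := mul_nonneg hℓ.le (sq_nonneg _)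
    have hsq : y ^ 2 ≤ q ^ 2 := pow_le_pow_left₀ hy hyq 2
    rw [hA]
    linarith
  have hA_pos : 0 < A := by linarith [sq_nonneg y]
  have hεA : 2 * y ^ 2 ≤ ε * A := by
    have h : 1 - ε ≤ δ / A := by
      linarith [div_le_div_of_nonneg_left hδ.le hA_pos hA_upper]
    rw [le_div_iff₀ hA_pos] at h
    linarith
  have hs : Real.sqrt ε ^ 2 = ε := Real.sq_sqrt hε₃.le
  have hcross : (K * y) ^ 2 ≤ 4 * (Real.sqrt ε ^ 2 * A) := by
    have h : K ^ 2 * y ^ 2 ≤ 1 * y ^ 2 :=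
      mul_le_mul_of_nonneg_right (pow_le_one₀ hK₀ hK₁) (sq_nonneg y)
    rw [hs, mul_pow]
    linarith [sq_nonneg y]
  have hχA : χ ≤ A := by
    rw [hχ]
    linarith [min_le_left δ 1, sq_nonneg y]
  have key := quadratic_form_lower_bound (Real.sqrt_pos.2 hε₃)
    (Real.sqrt_le_one.2 hε₂.le) hcross hχA (hχ ▸ min_le_right δ 1) w₁ w₂
  have hscale : 0 ≤ y / (2 * ℓ) := by positivity
  calc _ = y / (2 * ℓ) * (χ * (1 - Real.sqrt ε) * (w₁ ^ 2 + w₂ ^ 2)) := by ring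
    _ ≤ y / (2 * ℓ) * (A * w₁ ^ 2 + K * y * w₁ * w₂ + w₂ ^ 2) :=
      mul_le_mul_of_nonneg_left key hscale
    _ = _ := by
      rw [hA]
      field_simp
      ring
end
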